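/- (Non-Convexity Condition, part 2.) Let a ∈ (0,1], let A : ℝ² → L(ℝ², ℝ²) satisfy that A(x) is self-adjoint with operator norm ‖A(x)‖ ≤ 1 for every x, let C ⊆ ℝ² be a bounded measurable set with 0 < vol(C) < ∞ and 0 < Per(C) < ∞, set λ^A_C = a·Per(C)/vol(C), and suppose C is A-calibrable: there exists a measurable ξ : ℝ² → ℝ² with ‖ξ(x)‖ ≤ 1 for almost every x such that x ↦ A(x)(ξ(x)) has distributional divergence λ^A_C·χ_C. Then for every measurable set D ⊆ C of finite variational perimeter with vol(D) > 0, defining λ^A_D = a·Per(D)/vol(D), one has λ^A_C ≤ (1/a)·λ^A_D, i.e. Per(D)/vol(D) ≥ a·Per(C)/vol(C). -/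

import Mathlib

open MeasureTheory RealInnerProductSpace
open scoped ENNReal

/-- The Euclidean plane. -/
abbrev Plane := EuclideanSpace ℝ (Fin 2)

/-- The divergence of a planar vector field: the trace of its Fréchet
derivative. -/
noncomputable def divg (F : Plane → Plane) (x : Plane) : ℝ :=
  LinearMap.trace ℝ Plane (fderiv ℝ F x).toLinearMap

/-- The values `∫_E div ξ` over smooth compactly supported fields `ξ` with
`‖ξ‖ ≤ 1`, whose supremum is the variational perimeter of `E`. -/
def perimVals (E : Set Plane) : Set ℝ≥0∞ :=
  {r | ∃ ξ : Plane → Plane, ContDiff ℝ (⊤ : ℕ∞) ξ ∧ HasCompactSupport ξ ∧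
    (∀ x, ‖ξ x‖ ≤ 1) ∧ r = ENNReal.ofReal (∫ x in E, divg ξ x)}

/-- The variational perimeter of a set `E ⊆ ℝ²`. -/
noncomputable def Per (E : Set Plane) : ℝ≥0∞ := sSup (perimVals E)

/-- `η` has distributional divergence `λ · χ_C`:
`∫ ⟨η, ∇φ⟩ = -λ ∫_C φ` for every smooth compactly supported `φ`. -/
def HasDistribDiv (η : Plane → Plane) (lam : ℝ) (C : Set Plane) : Prop :=
  ∀ φ : Plane → ℝ, ContDiff ℝ (⊤ : ℕ∞) φ → HasCompactSupport φ →
    ∫ x : Plane, ⟪η x, gradient φ x⟫ = -lam * ∫ x in C, φ x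

open Filter

/-- The inner product with the gradient is the Fréchet derivative. -/
lemma inner_gradient_eq_fderiv (φ : Plane → ℝ) (x v : Plane) :
    ⟪v, gradient φ x⟫ = fderiv ℝ φ x v := by
  rw [real_inner_comm, ← toDual_gradient, InnerProductSpace.toDual_apply_apply]

/-- If the right-hand side of the divergence equation does not vanish, the left-hand side is
a genuine integral. -/
lemma HasDistribDiv.integrable_of_ne_zero {η : Plane → Plane} {lam : ℝ} {C : Set Plane}
    (h : HasDistribDiv η lam C) (hlam : lam ≠ 0) {φ : Plane → ℝ}
    (hφ : ContDiff ℝ (⊤ : ℕ∞) φ) (hφc : HasCompactSupport φ) (hne : ∫ x in C, φ x ≠ 0) :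
    Integrable (fun x => ⟪η x, gradient φ x⟫) := by
  by_contra hn
  have := h φ hφ hφc
  rw [integral_undef hn] at this
  exact mul_ne_zero (neg_ne_zero.2 hlam) hne this.symm

/-- A smooth cutoff function equal to one on a given closed ball around the origin. -/
lemma exists_cutoff (R : ℝ) :
    ∃ χ : Plane → ℝ, ContDiff ℝ (⊤ : ℕ∞) χ ∧ HasCompactSupport χ ∧ (∀ x, 0 ≤ χ x) ∧
      (∀ x, χ x ≤ 1) ∧ ∀ x ∈ Metric.ball (0 : Plane) R, χ =ᶠ[nhds x] 1 := by
  let f : ContDiffBump (0 : Plane) :=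
    ⟨max R 1, max R 1 + 1, lt_of_lt_of_le one_pos (le_max_right _ _), lt_add_one _⟩
  refine ⟨f, f.contDiff, f.hasCompactSupport, fun _ => f.nonneg, fun _ => f.le_one,
    fun x hx => f.eventuallyEq_one_of_mem_ball ?_⟩
  exact Metric.ball_subset_ball (le_max_left _ _) hx

/-- When `C` is bounded of positive measure and `lam ≠ 0`, all integrals in the definition of the
distributional divergence converge, even if `η` is not known to be measurable. -/
lemma HasDistribDiv.integrable {η : Plane → Plane} {lam : ℝ} {C : Set Plane}
    (h : HasDistribDiv η lam C) (hlam : lam ≠ 0) (hC : MeasurableSet C)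
    (hCbdd : Bornology.IsBounded C) (hv0 : volume C ≠ 0) {φ : Plane → ℝ}
    (hφ : ContDiff ℝ (⊤ : ℕ∞) φ) (hφc : HasCompactSupport φ) :
    Integrable (fun x => ⟪η x, gradient φ x⟫) := by
  by_cases hne : ∫ x in C, φ x = 0
  swap
  · exact h.integrable_of_ne_zero hlam hφ hφc hne
  obtain ⟨R, hR⟩ := hCbdd.subset_ball 0
  obtain ⟨χ, hχ, hχc, -, -, hχ1⟩ := exists_cutoff R
  have hχint : ∫ x in C, χ x = volume.real C := by
    rw [setIntegral_congr_fun (g := fun _ => (1 : ℝ)) hC fun x hx => (hχ1 x (hR hx)).eq_of_nhds]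
    simp
  have hpos : volume.real C ≠ 0 := by
    rw [Measure.real, ENNReal.toReal_ne_zero]
    exact ⟨hv0, hCbdd.measure_lt_top.ne⟩
  have h1 := h.integrable_of_ne_zero hlam hχ hχc (hχint ▸ hpos)
  have h2 := h.integrable_of_ne_zero hlam (φ := φ + χ) (hφ.add hχ) (hφc.add hχc) (by
    simp only [Pi.add_apply]
    rw [integral_add (hφ.continuous.integrable_of_hasCompactSupport hφc).integrableOn
      (hχ.continuous.integrable_of_hasCompactSupport hχc).integrableOn, hne, zero_add, hχint]
    exact hpos)
  refine (h2.sub h1).congr (Eventually.of_forall fun x => ?_)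
  simp only [Pi.sub_apply, inner_gradient_eq_fderiv]
  rw [fderiv_add (hφ.differentiable (by simp) x) (hχ.differentiable (by simp) x)]
  simp

/-- A field with a nontrivial distributional divergence on a bounded set of positive measure is
automatically almost everywhere measurable. -/
lemma HasDistribDiv.aestronglyMeasurable {η : Plane → Plane} {lam : ℝ} {C : Set Plane}
    (h : HasDistribDiv η lam C) (hlam : lam ≠ 0) (hC : MeasurableSet C)
    (hCbdd : Bornology.IsBounded C) (hv0 : volume C ≠ 0) :
    AEStronglyMeasurable η := by
  have key (v : Plane) : AEStronglyMeasurable (fun x => ⟪v, η x⟫) := by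
    rw [← Measure.restrict_univ (μ := (volume : Measure Plane)),
      ← Metric.iUnion_ball_nat (0 : Plane), aestronglyMeasurable_iUnion_iff]
    intro n
    obtain ⟨χ, hχ, hχc, -, -, hχ1⟩ := exists_cutoff n
    have hl : ContDiff ℝ (⊤ : ℕ∞) (fun x : Plane => ⟪v, x⟫) := (innerSL ℝ v).contDiff
    have hint := h.integrable hlam hC hCbdd hv0 (φ := fun x => χ x * ⟪v, x⟫)
      (hχ.mul hl) (hχc.mul_right)
    refine hint.aestronglyMeasurable.restrict.congr ?_
    filter_upwards [ae_restrict_mem Metric.isOpen_ball.measurableSet] with x hx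
    have he : (fun x => χ x * ⟪v, x⟫) =ᶠ[nhds x] innerSL ℝ v := by
      filter_upwards [hχ1 x hx] with y hy
      simp [hy]
    rw [inner_gradient_eq_fderiv, he.fderiv_eq, ContinuousLinearMap.fderiv, innerSL_apply_apply]
  let b := EuclideanSpace.basisFun (Fin 2) ℝ
  have hη : η = fun x => ∑ i, ⟪b i, η x⟫ • b i := funext fun x => (b.sum_repr' (η x)).symm
  rw [hη]
  exact Finset.aestronglyMeasurable_fun_sum _ fun i _ => (key (b i)).smul_const _

/-- The mollification of a planar vector field by a scalar kernel. -/
noncomputable def mollify (η : Plane → Plane) (ρ : Plane → ℝ) : Plane → Plane :=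
  convolution η ρ (ContinuousLinearMap.lsmul ℝ ℝ).flip volume

lemma mollify_apply (η : Plane → Plane) (ρ : Plane → ℝ) (x : Plane) :
    mollify η ρ x = ∫ t, ρ (x - t) • η t := rfl

lemma contDiff_mollify {η : Plane → Plane} {ρ : Plane → ℝ} (hη : LocallyIntegrable η)
    (hρ : ContDiff ℝ (⊤ : ℕ∞) ρ) (hρc : HasCompactSupport ρ) :
    ContDiff ℝ (⊤ : ℕ∞) (mollify η ρ) :=
  hρc.contDiff_convolution_right _ hη hρ

/-- Mollifying by a probability density does not increase the sup norm. -/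
lemma norm_mollify_le {η : Plane → Plane} {ρ : Plane → ℝ} (hη1 : ∀ᵐ x, ‖η x‖ ≤ 1)
    (hρ0 : ∀ x, 0 ≤ ρ x) (hρi : Integrable ρ) (hρ1 : ∫ x, ρ x = 1) (x : Plane) :
    ‖mollify η ρ x‖ ≤ 1 := by
  rw [mollify_apply]
  refine (norm_integral_le_of_norm_le (hρi.comp_sub_left x) ?_).trans_eq ?_
  · filter_upwards [hη1] with t ht
    rw [norm_smul, Real.norm_of_nonneg (hρ0 _)]
    exact mul_le_of_le_one_right (hρ0 _) ht
  · rw [integral_sub_left_eq_self, hρ1]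

/-- The divergence of the mollified field is the mollified distributional divergence. -/
lemma HasDistribDiv.divg_mollify {η : Plane → Plane} {lam : ℝ} {C : Set Plane}
    (h : HasDistribDiv η lam C) (hη : LocallyIntegrable η) {ρ : Plane → ℝ}
    (hρ : ContDiff ℝ (⊤ : ℕ∞) ρ) (hρc : HasCompactSupport ρ) (x : Plane) :
    divg (mollify η ρ) x = lam * ∫ t in C, ρ (x - t) := by
  have hρ1 : ContDiff ℝ 1 ρ := hρ.of_le (by exact_mod_cast le_top)
  let L : Plane →L[ℝ] ℝ →L[ℝ] Plane := (ContinuousLinearMap.lsmul ℝ ℝ).flip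
  have hd : fderiv ℝ (mollify η ρ) x = ∫ t, L.precompR Plane (η t) (fderiv ℝ ρ (x - t)) :=
    (hρc.hasFDerivAt_convolution_right L hη hρ1 x).fderiv
  have hi : Integrable fun t => L.precompR Plane (η t) (fderiv ℝ ρ (x - t)) :=
    (hρc.fderiv ℝ).convolutionExists_right (L.precompR Plane) hη
      (hρ1.continuous_fderiv one_ne_zero) x
  let T : (Plane →L[ℝ] Plane) →L[ℝ] ℝ := LinearMap.toContinuousLinearMap
    ((LinearMap.trace ℝ Plane).comp (ContinuousLinearMap.coeLM ℝ))
  have hT (t : Plane) : T (L.precompR Plane (η t) (fderiv ℝ ρ (x - t))) =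
      fderiv ℝ ρ (x - t) (η t) := by
    have : ((L.precompR Plane (η t) (fderiv ℝ ρ (x - t)) : Plane →L[ℝ] Plane) :
        Plane →ₗ[ℝ] Plane) = (fderiv ℝ ρ (x - t) : Plane →ₗ[ℝ] ℝ).smulRight (η t) := by
      ext v
      simp [L, ContinuousLinearMap.precompR_apply]
    exact (congrArg (LinearMap.trace ℝ Plane) this).trans (LinearMap.trace_smulRight _ _)
  have hφ := h (fun t => ρ (x - t)) (hρ.comp (contDiff_const.sub contDiff_id))
    (hρc.comp_homeomorph (Homeomorph.subLeft x))
  have hg (t : Plane) : ⟪η t, gradient (fun t => ρ (x - t)) t⟫ = -fderiv ℝ ρ (x - t) (η t) := by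
    rw [inner_gradient_eq_fderiv]
    have h1 : HasFDerivAt (fun t => x - t) (-ContinuousLinearMap.id ℝ Plane) t :=
      (hasFDerivAt_id t).const_sub x
    have h2 := ((hρ1.differentiable one_ne_zero (x - t)).hasFDerivAt).comp t h1
    rw [show (fun t => ρ (x - t)) = ρ ∘ fun t => x - t from rfl, h2.fderiv]
    simp
  simp only [hg, integral_neg] at hφ
  change T (fderiv ℝ (mollify η ρ) x) = _
  rw [hd, ← T.integral_comp_comm hi]
  simp only [hT]
  linarith

/-- The divergence integral of a smooth field bounded by one over a bounded set is at most the
perimeter: no compact support is needed. -/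
lemma integral_divg_le_per {F : Plane → Plane} (hF : ContDiff ℝ (⊤ : ℕ∞) F)
    (hF1 : ∀ x, ‖F x‖ ≤ 1) {D : Set Plane} (hD : MeasurableSet D)
    (hDbdd : Bornology.IsBounded D) (hPer : Per D ≠ ⊤) :
    ∫ x in D, divg F x ≤ (Per D).toReal := by
  obtain ⟨R, hR⟩ := hDbdd.subset_ball 0
  obtain ⟨χ, hχ, hχc, hχ0, hχle, hχ1⟩ := exists_cutoff R
  rw [← ENNReal.ofReal_le_iff_le_toReal hPer]
  refine le_sSup ⟨fun x => χ x • F x, hχ.smul hF, hχc.smul_right, fun x => ?_, ?_⟩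
  · rw [norm_smul, Real.norm_of_nonneg (hχ0 x)]
    exact mul_le_one₀ (hχle x) (norm_nonneg _) (hF1 x)
  · congr 1
    refine setIntegral_congr_fun hD fun x hx => ?_
    have he : (fun x => χ x • F x) =ᶠ[nhds x] F := by
      filter_upwards [hχ1 x (hR hx)] with y hy
      simp [hy]
    simp only [divg, he.fderiv_eq]

/-- If `η` is bounded by one and has divergence `lam · χ_C`, then `lam · vol D ≤ Per D` for every
bounded subset `D` of `C` of finite perimeter. -/
lemma HasDistribDiv.mul_volume_le_per {η : Plane → Plane} {lam : ℝ} {C D : Set Plane}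
    (h : HasDistribDiv η lam C) (hηm : AEStronglyMeasurable η) (hη1 : ∀ᵐ x, ‖η x‖ ≤ 1)
    (hC : MeasurableSet C) (hDC : D ⊆ C) (hD : MeasurableSet D)
    (hDbdd : Bornology.IsBounded D) (hPer : Per D ≠ ⊤) :
    lam * volume.real D ≤ (Per D).toReal := by
  have hη : LocallyIntegrable η :=
    (locallyIntegrable_const (1 : ℝ)).mono hηm (by simpa using hη1)
  let f : Plane → ℝ := C.indicator fun _ => 1
  have hf : LocallyIntegrable f := (locallyIntegrable_const (1 : ℝ)).indicator hC
  let φ (n : ℕ) : ContDiffBump (0 : Plane) :=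
    ⟨1 / ((n : ℝ) + 1), 2 * (1 / ((n : ℝ) + 1)), by positivity,
      lt_two_mul_self (by positivity)⟩
  let ρ (n : ℕ) : Plane → ℝ := (φ n).normed volume
  have hφ0 : Tendsto (fun n => (φ n).rOut) atTop (nhds 0) := by
    simpa [φ] using (tendsto_one_div_add_atTop_nhds_zero_nat (𝕜 := ℝ)).const_mul 2
  have hconv (n : ℕ) (x : Plane) :
      convolution (ρ n) f (ContinuousLinearMap.lsmul ℝ ℝ) volume x = ∫ t in C, ρ n (x - t) := by
    rw [convolution_lsmul_swap, ← integral_indicator hC]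
    congr 1 with t
    by_cases ht : t ∈ C <;> simp [f, ht]
  have hlim := ContDiffBump.ae_convolution_tendsto_right_of_locallyIntegrable hφ0
    (K := 2) (Eventually.of_forall fun n => le_rfl) hf
  have hle (n : ℕ) : lam * ∫ x in D, ∫ t in C, ρ n (x - t) ≤ (Per D).toReal := by
    have hρ : ContDiff ℝ (⊤ : ℕ∞) (ρ n) := (φ n).contDiff_normed
    have hρc : HasCompactSupport (ρ n) := (φ n).hasCompactSupport_normed
    have := integral_divg_le_per (contDiff_mollify hη hρ hρc)
      (norm_mollify_le hη1 (φ n).nonneg_normed (φ n).integrable_normed (φ n).integral_normed)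
      hD hDbdd hPer
    simpa only [h.divg_mollify hη hρ hρc, integral_const_mul] using this
  refine le_of_tendsto' (x := atTop) (Tendsto.const_mul lam ?_) hle
  have hone : ∫ _ in D, (1 : ℝ) = volume.real D := by simp
  rw [← hone]
  refine tendsto_integral_of_dominated_convergence (fun _ => 1) (fun n => ?_) ?_ (fun n => ?_) ?_
  · simp only [← hconv]
    exact ((φ n).hasCompactSupport_normed.continuous_convolution_left _
      (φ n).continuous_normed hf).aestronglyMeasurable
  · exact integrableOn_const hDbdd.measure_lt_top.ne
  · refine Eventually.of_forall fun x => ?_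
    have h0 : ∀ t, 0 ≤ ρ n (x - t) := fun t => (φ n).nonneg_normed _
    rw [Real.norm_of_nonneg (integral_nonneg h0)]
    refine (setIntegral_le_integral ((φ n).integrable_normed.comp_sub_left x)
      (Eventually.of_forall h0)).trans_eq ?_
    rw [integral_sub_left_eq_self (ρ n)]
    exact (φ n).integral_normed
  · filter_upwards [ae_restrict_mem hD, ae_restrict_of_ae hlim] with x hx hxl
    simpa only [f, Set.indicator_of_mem (hDC hx), ← hconv] using hxl

/-- Non-convexity condition, part 2: if `C` is `A`-calibrable with anisotropy
parameter `a ∈ (0,1]`, then for every measurable subset `D ⊆ C` of finite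
perimeter and positive volume, `λ^A_C ≤ (1/a) · λ^A_D`, where
`λ^A_E = a · Per E / vol E`; i.e. `Per D / vol D ≥ a · Per C / vol C`. -/
theorem A_calibrable_subset_eigenvalue_ge
    (a : ℝ) (ha : a ∈ Set.Ioc (0 : ℝ) 1)
    (A : Plane → (Plane →L[ℝ] Plane))
    (hAsa : ∀ x : Plane, ∀ y z : Plane, ⟪A x y, z⟫ = ⟪y, A x z⟫)
    (hAnorm : ∀ x : Plane, ‖A x‖ ≤ 1)
    (C : Set Plane) (hC : MeasurableSet C) (hCbdd : Bornology.IsBounded C)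
    (hv0 : volume C ≠ 0) (hvT : volume C ≠ ⊤)
    (hp0 : Per C ≠ 0) (hpT : Per C ≠ ⊤)
    (ξ : Plane → Plane) (hξm : Measurable ξ)
    (hξ1 : ∀ᵐ x : Plane, ‖ξ x‖ ≤ 1)
    (hdiv : HasDistribDiv (fun x => A x (ξ x))
      (a * (Per C).toReal / (volume C).toReal) C) :
    ∀ D : Set Plane, D ⊆ C → MeasurableSet D → Per D ≠ ⊤ → volume D ≠ 0 →
      a * (Per C).toReal / (volume C).toReal ≤
        (1 / a) * (a * (Per D).toReal / (volume D).toReal) := by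
  intro D hDC hD hPD hvD
  have hDbdd := hCbdd.subset hDC
  have hvDpos : 0 < volume.real D := ENNReal.toReal_pos hvD hDbdd.measure_lt_top.ne
  have hlam : a * (Per C).toReal / (volume C).toReal ≠ 0 :=
    (div_pos (mul_pos ha.1 (ENNReal.toReal_pos hp0 hpT)) (ENNReal.toReal_pos hv0 hvT)).ne'
  have hη1 : ∀ᵐ x, ‖A x (ξ x)‖ ≤ 1 := by
    filter_upwards [hξ1] with x hx
    exact ((A x).le_of_opNorm_le (hAnorm x) _).trans (by simpa using hx)
  have hηm := hdiv.aestronglyMeasurable hlam hC hCbdd hv0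
  have hmain := hdiv.mul_volume_le_per hηm hη1 hC hDC hD hDbdd hPD
  rw [← le_div_iff₀ hvDpos] at hmain
  refine hmain.trans_eq ?_
  rw [mul_div_assoc, ← mul_assoc, one_div_mul_cancel ha.1.ne', one_mul]
  rfl
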